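/- arXiv:2011.03533 — 2 statements merged into one kernel-verified Lean document; each statement's English description precedes it below -/
import Mathlib

section
/- Let n ≥ 2 be an integer. (a) Every smooth compactly supported function φ : (0,∞) → ℝ satisfies the Hardy inequality ∫₀^∞ φ′(s)² sⁿ ds ≥ ((n−1)²/4)·∫₀^∞ φ(s)² s^{n−2} ds. (b) The constant (n−1)²/4 is optimal: for every ε > 0 there exists a smooth compactly supported φ : (0,∞) → ℝ, not identically zero, with ∫₀^∞ φ′(s)² sⁿ ds < ((n−1)²/4 + ε)·∫₀^∞ φ(s)² s^{n−2} ds. -/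
open Real MeasureTheory

/-- The difference of the two sides of the Hardy inequality is the integral of a square. -/
theorem hardy_identity (m : ℕ) (φ : ℝ → ℝ) (hφ : ContDiff ℝ (⊤ : ℕ∞) φ)
    (hc : HasCompactSupport φ) :
    (∫ s in Set.Ioi (0 : ℝ), deriv φ s ^ 2 * s ^ (m + 2))
      = ((m + 1 : ℝ) / 2) ^ 2 * (∫ s in Set.Ioi (0 : ℝ), φ s ^ 2 * s ^ m)
        + ∫ s in Set.Ioi (0 : ℝ), s ^ m * (s * deriv φ s + (m + 1 : ℝ) / 2 * φ s) ^ 2 := by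
  have hd : Continuous (deriv φ) := hφ.continuous_deriv (by simp)
  have hcd : HasCompactSupport (deriv φ) := hc.deriv
  have hφc := hφ.continuous
  have i1 : Integrable fun s ↦ deriv φ s ^ 2 * s ^ (m + 2) := by
    refine Continuous.integrable_of_hasCompactSupport (by fun_prop) (hcd.mono fun s hs h ↦ ?_)
    simp_all
  have i2 : Integrable fun s ↦ φ s ^ 2 * s ^ m := by
    refine Continuous.integrable_of_hasCompactSupport (by fun_prop) (hc.mono fun s hs h ↦ ?_)
    simp_all
  have i3 : Integrable fun s ↦
      2 * φ s * deriv φ s * s ^ (m + 1) + (m + 1) * (φ s ^ 2 * s ^ m) := by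
    refine Continuous.integrable_of_hasCompactSupport (by fun_prop) (hc.mono fun s hs h ↦ ?_)
    simp_all
  have hder (s : ℝ) : HasDerivAt (fun s ↦ φ s ^ 2 * s ^ (m + 1))
      (2 * φ s * deriv φ s * s ^ (m + 1) + (m + 1) * (φ s ^ 2 * s ^ m)) s := by
    have h := ((hφ.differentiable (by simp) s).hasDerivAt.pow 2).mul (hasDerivAt_pow (m + 1) s)
    refine h.congr_deriv ?_
    simp only [Pi.pow_apply, Nat.add_sub_cancel]
    push_cast
    ring
  have hcs : HasCompactSupport fun s ↦ φ s ^ 2 * s ^ (m + 1) :=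
    hc.mono fun s hs h ↦ by simp_all
  have hI : ∫ s in Set.Ioi (0 : ℝ),
      (2 * φ s * deriv φ s * s ^ (m + 1) + (m + 1) * (φ s ^ 2 * s ^ m)) = 0 := by
    rw [integral_Ioi_of_hasDerivAt_of_tendsto' (f := fun s ↦ φ s ^ 2 * s ^ (m + 1)) (m := 0)
      (fun s _ ↦ hder s) i3.integrableOn]
    · simp
    · exact hcs.is_zero_at_infty.mono_left atTop_le_cocompact
  have key : ∀ s : ℝ, s ^ m * (s * deriv φ s + (m + 1 : ℝ) / 2 * φ s) ^ 2
      = deriv φ s ^ 2 * s ^ (m + 2) - ((m + 1 : ℝ) / 2) ^ 2 * (φ s ^ 2 * s ^ m)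
        + (m + 1 : ℝ) / 2 *
          (2 * φ s * deriv φ s * s ^ (m + 1) + (m + 1) * (φ s ^ 2 * s ^ m)) := by
    intro s
    ring
  have i4 : Integrable fun s ↦ deriv φ s ^ 2 * s ^ (m + 2)
      - ((m + 1 : ℝ) / 2) ^ 2 * (φ s ^ 2 * s ^ m) := i1.sub (i2.const_mul _)
  simp_rw [key]
  rw [integral_add i4.integrableOn (i3.const_mul _).integrableOn,
    integral_sub i1.integrableOn (i2.const_mul _).integrableOn, integral_const_mul,
    integral_const_mul, hI]
  ring

/-- The substitution `s = exp (R u)`. -/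
theorem integral_Ioi_zero_eq_integral_exp_mul {R : ℝ} (hR : 0 < R) (g : ℝ → ℝ) :
    ∫ s in Set.Ioi (0 : ℝ), g s = ∫ u, R * rexp (R * u) * g (rexp (R * u)) := by
  have himg : (fun u ↦ rexp (R * u)) '' Set.univ = Set.Ioi 0 := by
    ext s
    constructor
    · rintro ⟨u, -, rfl⟩
      exact exp_pos _
    · intro hs
      refine ⟨log s / R, trivial, ?_⟩
      simp only
      rw [mul_div_cancel₀ _ hR.ne', exp_log hs]
  rw [← himg, integral_image_eq_integral_abs_deriv_smul MeasurableSet.univ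
    (f' := fun u ↦ R * rexp (R * u))]
  · rw [setIntegral_univ]
    refine integral_congr_ae (.of_forall fun u ↦ ?_)
    simp only [smul_eq_mul]
    rw [abs_of_pos (by positivity)]
  · intro u _
    refine HasDerivAt.hasDerivWithinAt ?_
    simpa [mul_comm] using ((hasDerivAt_id u).const_mul R).exp
  · intro u _ v _ h
    simpa [hR.ne'] using h

/-- The virtual extremal `s ^ (-c)` cut off, on the logarithmic scale `R`, by `χ`. -/
noncomputable def logCutoff (χ : ℝ → ℝ) (c R s : ℝ) : ℝ :=
  if 0 < s then rexp (-c * log s) * χ (log s / R) else 0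

theorem tsupport_logCutoff_subset {χ : ℝ → ℝ} {r : ℝ} (hχ : ∀ u, r < |u| → χ u = 0)
    (c : ℝ) {R : ℝ} (hR : 0 < R) :
    tsupport (logCutoff χ c R) ⊆ Set.Icc (rexp (-(r * R))) (rexp (r * R)) := by
  refine closure_minimal (fun s hs ↦ ?_) isClosed_Icc
  rw [Function.mem_support, logCutoff] at hs
  split_ifs at hs with h
  · have h2 : |log s / R| ≤ r := by
      by_contra! h3
      exact hs (by rw [hχ _ h3, mul_zero])
    rw [abs_div, abs_of_pos hR, div_le_iff₀ hR, abs_le] at h2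
    exact ⟨(le_log_iff_exp_le h).1 h2.1, (log_le_iff_le_exp h).1 h2.2⟩
  · exact absurd rfl hs

theorem logCutoff_eventuallyEq (χ : ℝ → ℝ) (c R : ℝ) {s : ℝ} (hs : 0 < s) :
    logCutoff χ c R =ᶠ[nhds s] fun s ↦ rexp (-c * log s) * χ (log s / R) := by
  filter_upwards [Ioi_mem_nhds hs] with t ht
  exact if_pos ht

theorem contDiff_logCutoff {χ : ℝ → ℝ} (hχ : ContDiff ℝ (⊤ : ℕ∞) χ) (c R : ℝ)
    (h0 : tsupport (logCutoff χ c R) ⊆ Set.Ioi 0) :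
    ContDiff ℝ (⊤ : ℕ∞) (logCutoff χ c R) := by
  rw [contDiff_iff_contDiffAt]
  intro s
  by_cases hs : s ∈ tsupport (logCutoff χ c R)
  · have hs0 : 0 < s := h0 hs
    have hl : ContDiffAt ℝ (⊤ : ℕ∞) log s := contDiffAt_log.2 hs0.ne'
    refine ContDiffAt.congr_of_eventuallyEq ?_ (logCutoff_eventuallyEq χ c R hs0)
    exact (contDiffAt_const.mul hl).exp.mul (hχ.contDiffAt.comp s (hl.div_const R))
  · exact contDiffAt_const.congr_of_eventuallyEq (notMem_tsupport_iff_eventuallyEq.1 hs)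

theorem mul_deriv_logCutoff_add {χ : ℝ → ℝ} (hχ : Differentiable ℝ χ) (c R : ℝ) {s : ℝ}
    (hs : 0 < s) :
    s * deriv (logCutoff χ c R) s + c * logCutoff χ c R s
      = rexp (-c * log s) * deriv χ (log s / R) / R := by
  have hl := hasDerivAt_log hs.ne'
  have h := ((hl.const_mul (-c)).exp).mul
    ((hχ (log s / R)).hasDerivAt.comp s (hl.div_const R))
  have hd : deriv (logCutoff χ c R) s = _ :=
    (h.congr_of_eventuallyEq (logCutoff_eventuallyEq χ c R hs)).deriv
  rw [hd, logCutoff, if_pos hs]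
  simp only [Function.comp_apply]
  field_simp
  ring

theorem integral_logCutoff_weight (χ : ℝ → ℝ) (m : ℕ) {R : ℝ} (hR : 0 < R) :
    ∫ s in Set.Ioi (0 : ℝ), s ^ m * (rexp (-((m + 1 : ℝ) / 2) * log s) * χ (log s / R)) ^ 2
      = R * ∫ u, χ u ^ 2 := by
  rw [integral_Ioi_zero_eq_integral_exp_mul hR, ← integral_const_mul]
  refine integral_congr_ae (.of_forall fun u ↦ ?_)
  have he : rexp (R * u) * (rexp (R * u) ^ m * rexp (-((m + 1 : ℝ) / 2) * (R * u)) ^ 2) = 1 := by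
    rw [← exp_nat_mul, ← exp_nat_mul, ← exp_add, ← exp_add, exp_eq_one_iff]
    push_cast
    ring
  simp only [log_exp, mul_div_cancel_left₀ _ hR.ne']
  linear_combination R * χ u ^ 2 * he

/-- The Hardy inequality on `(0,∞)` with weight `sⁿ`, together with the optimality of
the constant `(n-1)²/4`. -/
theorem hardy_inequality_and_optimality (n : ℕ) (hn : 2 ≤ n) :
    (∀ φ : ℝ → ℝ, ContDiff ℝ (⊤ : ℕ∞) φ → HasCompactSupport φ → tsupport φ ⊆ Set.Ioi 0 →
      ((n : ℝ) - 1) ^ 2 / 4 * ∫ s in Set.Ioi (0 : ℝ), φ s ^ 2 * s ^ (n - 2)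
        ≤ ∫ s in Set.Ioi (0 : ℝ), deriv φ s ^ 2 * s ^ n)
    ∧ (∀ ε : ℝ, 0 < ε → ∃ φ : ℝ → ℝ, ContDiff ℝ (⊤ : ℕ∞) φ ∧ HasCompactSupport φ ∧
        tsupport φ ⊆ Set.Ioi 0 ∧ φ ≠ 0 ∧
        (∫ s in Set.Ioi (0 : ℝ), deriv φ s ^ 2 * s ^ n)
          < (((n : ℝ) - 1) ^ 2 / 4 + ε) * ∫ s in Set.Ioi (0 : ℝ), φ s ^ 2 * s ^ (n - 2)) := by
  obtain ⟨m, rfl⟩ := Nat.exists_eq_add_of_le' hn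
  have hconst : (((m + 2 : ℕ) : ℝ) - 1) ^ 2 / 4 = ((m + 1 : ℝ) / 2) ^ 2 := by
    push_cast
    ring
  rw [hconst, Nat.add_sub_cancel]
  refine ⟨fun φ hφ hc _ ↦ ?_, fun ε hε ↦ ?_⟩
  · rw [hardy_identity m φ hφ hc, le_add_iff_nonneg_right]
    refine setIntegral_nonneg measurableSet_Ioi fun s hs ↦ ?_
    have : (0 : ℝ) < s := hs
    positivity
  let χ : ContDiffBump (0 : ℝ) := ⟨1, 2, one_pos, one_lt_two⟩
  have hχ : ContDiff ℝ (⊤ : ℕ∞) χ := χ.contDiff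
  have hχ0 (u : ℝ) (hu : 2 < |u|) : χ u = 0 :=
    χ.zero_of_le_dist (by simpa [dist_zero_right] using hu.le)
  have hB : 0 < ∫ u, χ u ^ 2 := by
    refine Continuous.integral_pos_of_hasCompactSupport_nonneg_nonzero (x := 0)
      (χ.continuous.pow 2) (χ.hasCompactSupport.mono fun u hu h ↦ ?_) (fun u ↦ sq_nonneg _) ?_
    · simp_all
    · simp [χ.one_of_mem_closedBall (Metric.mem_closedBall_self χ.rIn_pos.le)]
  set A := ∫ u, deriv χ u ^ 2
  set B := ∫ u, χ u ^ 2
  have hA : 0 ≤ A := integral_nonneg fun u ↦ sq_nonneg _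
  obtain ⟨R, hR, hAR⟩ : ∃ R : ℝ, 1 ≤ R ∧ A < ε * B * R := by
    refine ⟨A / (ε * B) + 1, by linarith [div_nonneg hA (mul_pos hε hB).le], ?_⟩
    rw [mul_add, mul_div_cancel₀ _ (mul_pos hε hB).ne']
    linarith [mul_pos hε hB]
  have hR0 : 0 < R := one_pos.trans_le hR
  set c : ℝ := (m + 1 : ℝ) / 2
  set φ := logCutoff χ c R
  have hsupp : tsupport φ ⊆ Set.Icc (rexp (-(2 * R))) (rexp (2 * R)) :=
    tsupport_logCutoff_subset hχ0 c hR0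
  have h0 : tsupport φ ⊆ Set.Ioi 0 := fun s hs ↦ (exp_pos _).trans_le (hsupp hs).1
  have hφ : ContDiff ℝ (⊤ : ℕ∞) φ := contDiff_logCutoff hχ c R h0
  have hcs : HasCompactSupport φ := isCompact_Icc.of_isClosed_subset (isClosed_tsupport φ) hsupp
  have hφB : ∫ s in Set.Ioi (0 : ℝ), φ s ^ 2 * s ^ m = R * B := by
    rw [← integral_logCutoff_weight χ m hR0]
    refine setIntegral_congr_fun measurableSet_Ioi fun s hs ↦ ?_
    simp only [φ, logCutoff, if_pos (Set.mem_Ioi.1 hs)]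
    ring
  have hφA : ∫ s in Set.Ioi (0 : ℝ), s ^ m * (s * deriv φ s + c * φ s) ^ 2 = A / R := by
    have : A / R = (R * A) / R ^ 2 := by field_simp
    rw [this, ← integral_logCutoff_weight (deriv χ) m hR0, ← integral_div]
    refine setIntegral_congr_fun measurableSet_Ioi fun s hs ↦ ?_
    rw [mul_deriv_logCutoff_add (hχ.differentiable (by simp)) c R hs]
    ring
  refine ⟨φ, hφ, hcs, h0, fun h ↦ ?_, ?_⟩
  · rw [h] at hφB
    simp only [Pi.zero_apply, ne_eq, OfNat.ofNat_ne_zero, not_false_eq_true, zero_pow, zero_mul,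
      integral_zero] at hφB
    exact (mul_pos hR0 hB).ne hφB
  · rw [hardy_identity m φ hφ hcs, hφA, hφB, add_mul]
    gcongr
    rw [div_lt_iff₀ hR0]
    nlinarith [mul_pos hε hB]
end

section
/- Let n ≥ 3 be an integer and let μ < −(n−1)²/4 be a real number. Then for every C > 0 there exists a smooth compactly supported function φ : (0,π) → ℝ, not identically zero, such that ∫₀^π φ′(θ)² sinⁿ(θ) dθ + μ·∫₀^π φ(θ)² sin^{n−2}(θ) dθ ≤ −C·∫₀^π φ(θ)² sinⁿ(θ) dθ. In particular, the infimum over nonzero φ ∈ C_c^∞((0,π)) of the quotient (∫₀^π φ′² sinⁿ dθ + μ ∫₀^π φ² sin^{n−2} dθ)/(∫₀^π φ² sinⁿ dθ) is −∞. -/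
open Real MeasureTheory

/-- The coordinate `t = log tan (θ/2)` on `(0, π)`, for which `dt = dθ / sin θ`. -/
noncomputable def logTanHalf (θ : ℝ) : ℝ := log (tan (θ / 2))

/-- The inverse `θ = 2 arctan (exp t)` of `logTanHalf`. -/
noncomputable def gudermann (t : ℝ) : ℝ := 2 * arctan (exp t)

theorem gudermann_mem (t : ℝ) : gudermann t ∈ Set.Ioo 0 π := by
  have h1 := arctan_pos.2 (exp_pos t)
  have h2 := arctan_lt_pi_div_two (exp t)
  unfold gudermann
  constructor <;> linarith

theorem logTanHalf_gudermann (t : ℝ) : logTanHalf (gudermann t) = t := by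
  simp [logTanHalf, gudermann]

theorem tan_half_pos {θ : ℝ} (h : θ ∈ Set.Ioo 0 π) : 0 < tan (θ / 2) :=
  tan_pos_of_pos_of_lt_pi_div_two (by linarith [h.1]) (by linarith [h.2])

theorem cos_half_pos {θ : ℝ} (h : θ ∈ Set.Ioo 0 π) : 0 < cos (θ / 2) :=
  cos_pos_of_mem_Ioo ⟨by linarith [h.1, pi_pos], by linarith [h.2]⟩

theorem gudermann_logTanHalf {θ : ℝ} (h : θ ∈ Set.Ioo 0 π) : gudermann (logTanHalf θ) = θ := by
  rw [gudermann, logTanHalf, exp_log (tan_half_pos h),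
    arctan_tan (by linarith [h.1, pi_pos]) (by linarith [h.2])]
  ring

theorem continuous_gudermann : Continuous gudermann := by
  unfold gudermann
  fun_prop

theorem contDiffAt_logTanHalf {θ : ℝ} (h : θ ∈ Set.Ioo 0 π) {k : WithTop ℕ∞} :
    ContDiffAt ℝ k logTanHalf θ := by
  have h1 : ContDiffAt ℝ k (fun θ => tan (θ / 2)) θ :=
    (contDiffAt_tan.2 (cos_half_pos h).ne').comp (f := fun θ : ℝ => θ / 2) θ (by fun_prop)
  exact h1.log (tan_half_pos h).ne'

theorem sin_eq_half {θ : ℝ} : sin θ = 2 * sin (θ / 2) * cos (θ / 2) := by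
  rw [← sin_two_mul]; congr 1; ring

theorem hasDerivAt_logTanHalf {θ : ℝ} (h : θ ∈ Set.Ioo 0 π) :
    HasDerivAt logTanHalf (sin θ)⁻¹ θ := by
  have hc := cos_half_pos h
  have hs : 0 < sin (θ / 2) :=
    sin_pos_of_pos_of_lt_pi (by linarith [h.1]) (by linarith [h.2, pi_pos])
  have h1 : HasDerivAt (fun θ => tan (θ / 2)) (1 / cos (θ / 2) ^ 2 * (1 / 2)) θ :=
    (hasDerivAt_tan hc.ne').comp (h := fun θ : ℝ => θ / 2) θ ((hasDerivAt_id θ).div_const 2)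
  refine (h1.log (tan_half_pos h).ne').congr_deriv ?_
  rw [tan_eq_sin_div_cos, sin_eq_half (θ := θ)]
  field_simp

theorem sin_le_two_mul_exp_logTanHalf {θ : ℝ} (h : θ ∈ Set.Ioo 0 π) :
    sin θ ≤ 2 * exp (logTanHalf θ) := by
  have hc := cos_half_pos h
  have ht := tan_half_pos h
  have h1 := tan_mul_cos hc.ne'
  rw [logTanHalf, exp_log ht, sin_eq_half, ← h1]
  have h2 : cos (θ / 2) ^ 2 ≤ 1 := cos_sq_le_one _
  nlinarith

theorem injOn_logTanHalf : Set.InjOn logTanHalf (Set.Ioo 0 π) :=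
  Set.LeftInvOn.injOn (f₁' := gudermann) fun _ h => gudermann_logTanHalf h

theorem image_logTanHalf : logTanHalf '' Set.Ioo 0 π = Set.univ :=
  Set.eq_univ_of_forall fun t => ⟨gudermann t, gudermann_mem t, logTanHalf_gudermann t⟩

theorem integral_comp_logTanHalf (G : ℝ → ℝ) :
    ∫ θ in Set.Ioo 0 π, (sin θ)⁻¹ * G (logTanHalf θ) = ∫ t, G t := by
  rw [← setIntegral_univ (f := G), ← image_logTanHalf,
    integral_image_eq_integral_abs_deriv_smul measurableSet_Ioo
      (fun θ h => (hasDerivAt_logTanHalf h).hasDerivWithinAt) injOn_logTanHalf]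
  refine setIntegral_congr_fun measurableSet_Ioo fun θ h => ?_
  simp [abs_of_pos (sin_pos_of_pos_of_lt_pi h.1 h.2)]

theorem integrableOn_comp_logTanHalf {G : ℝ → ℝ} (hG : Integrable G) :
    IntegrableOn (fun θ => (sin θ)⁻¹ * G (logTanHalf θ)) (Set.Ioo 0 π) := by
  rw [← integrableOn_univ, ← image_logTanHalf,
    integrableOn_image_iff_integrableOn_abs_deriv_smul measurableSet_Ioo
      (fun θ h => (hasDerivAt_logTanHalf h).hasDerivWithinAt) injOn_logTanHalf] at hG
  refine hG.congr_fun (fun θ h => ?_) measurableSet_Ioo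
  simp [abs_of_pos (sin_pos_of_pos_of_lt_pi h.1 h.2)]

/-- Translated dilates of a fixed bump, supported far to the left, have Dirichlet energy that is
arbitrarily small compared with their `L²` norm. -/
theorem exists_bump_small_energy {A : ℝ} (hA : 0 < A) (T : ℝ) :
    ∃ ψ : ℝ → ℝ, ContDiff ℝ (⊤ : ℕ∞) ψ ∧ HasCompactSupport ψ ∧ (∃ t, ψ t ≠ 0) ∧
      (∀ t, ψ t ≠ 0 → t ≤ T) ∧
      (∫ t, (A * deriv ψ t ^ 2 - ψ t ^ 2)) ≤ 0 := by
  obtain ⟨χ, hχ, hχc, hsupp, h0⟩ : ∃ χ : ℝ → ℝ, ContDiff ℝ (⊤ : ℕ∞) χ ∧ HasCompactSupport χ ∧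
      (∀ x, χ x ≠ 0 → x < 2) ∧ χ 0 = 1 := by
    let χ : ContDiffBump (0 : ℝ) := ⟨1, 2, one_pos, one_lt_two⟩
    refine ⟨χ, χ.contDiff, χ.hasCompactSupport, fun x hx => ?_,
      χ.one_of_mem_closedBall (Metric.mem_closedBall_self zero_le_one)⟩
    have : x ∈ Metric.ball (0 : ℝ) 2 := by
      rw [← show Function.support χ = Metric.ball (0 : ℝ) 2 from χ.support_eq]
      exact hx
    rw [Metric.mem_ball, dist_zero_right, Real.norm_eq_abs, abs_lt] at this
    exact this.2
  have hd : Continuous (deriv χ) := hχ.continuous_deriv (by simp)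
  have hsq {f : ℝ → ℝ} (hf : HasCompactSupport f) : HasCompactSupport fun x => f x ^ 2 :=
    hf.mono fun x hx h => hx (by simp [h])
  have hc1 : Continuous fun x => deriv χ x ^ 2 := by fun_prop
  have hc2 : Continuous fun x => χ x ^ 2 := hχ.continuous.pow 2
  have hi1 : Integrable fun x => deriv χ x ^ 2 :=
    hc1.integrable_of_hasCompactSupport (hsq hχc.deriv)
  have hi2 : Integrable fun x => χ x ^ 2 := hc2.integrable_of_hasCompactSupport (hsq hχc)
  have hpos : 0 < ∫ x, χ x ^ 2 :=
    hc2.integral_pos_of_hasCompactSupport_nonneg_nonzero (x := 0) (hsq hχc)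
      (fun x => sq_nonneg (χ x)) (by simp [h0])
  set D := ∫ x, deriv χ x ^ 2 with hD
  set N := ∫ x, χ x ^ 2 with hN
  have hD0 : 0 ≤ D := integral_nonneg fun x => sq_nonneg _
  obtain ⟨ε, hε, hεle⟩ : ∃ ε > 0, A * ε ^ 2 * D ≤ N := by
    refine ⟨√(N / (A * (D + 1))), by positivity, ?_⟩
    rw [sq_sqrt (by positivity), show A * (N / (A * (D + 1))) * D = N * (D / (D + 1)) by
      field_simp]
    exact mul_le_of_le_one_right hpos.le (by rw [div_le_one] <;> linarith)
  set b := 2 - ε * T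
  have hder (t : ℝ) : deriv (fun t => χ (ε * t + b)) t = ε * deriv χ (ε * t + b) := by
    have := ((hχ.differentiable (by simp)) (ε * t + b)).hasDerivAt.comp t
      (((hasDerivAt_id t).const_mul ε).add_const b)
    simpa [mul_comm, Function.comp_def] using this.deriv
  refine ⟨fun t => χ (ε * t + b), hχ.comp (by fun_prop), ?_, ⟨-b / ε, ?_⟩, ?_, ?_⟩
  · exact hχc.comp_homeomorph
      ((Homeomorph.mulLeft₀ ε hε.ne').trans (Homeomorph.addRight b))
  · beta_reduce
    rw [show ε * (-b / ε) + b = 0 by field_simp; ring, h0]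
    exact one_ne_zero
  · intro t ht
    have := hsupp _ ht
    nlinarith
  · simp only [hder]
    have h1 := Measure.integral_comp_mul_left
      (fun x => A * (ε * deriv χ (x + b)) ^ 2 - χ (x + b) ^ 2) ε
    rw [h1, integral_add_right_eq_self (fun x => A * (ε * deriv χ x) ^ 2 - χ x ^ 2) b]
    have h2 : ∫ x, (A * (ε * deriv χ x) ^ 2 - χ x ^ 2) = A * ε ^ 2 * D - N := by
      rw [hD, hN, ← integral_const_mul, ← integral_sub (hi1.const_mul _) hi2]
      congr 1; ext x; ring
    rw [h2, smul_eq_mul]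
    exact mul_nonpos_of_nonneg_of_nonpos (abs_nonneg _) (by linarith)

/-- If `μ < -(n-1)²/4`, the quadratic form
`φ ↦ ∫ φ'² sinⁿ + μ ∫ φ² sin^{n-2}` is unbounded below relative to `∫ φ² sinⁿ`
on compactly supported smooth functions on `(0,π)`. -/
theorem quadratic_form_unbounded_below (n : ℕ) (hn : 3 ≤ n) (μ : ℝ)
    (hμ : μ < -(((n : ℝ) - 1) ^ 2 / 4)) :
    ∀ C : ℝ, 0 < C → ∃ φ : ℝ → ℝ, ContDiff ℝ (⊤ : ℕ∞) φ ∧ HasCompactSupport φ ∧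
      tsupport φ ⊆ Set.Ioo 0 π ∧ φ ≠ 0 ∧
      (∫ θ in Set.Ioo (0 : ℝ) π, deriv φ θ ^ 2 * sin θ ^ n)
        + μ * ∫ θ in Set.Ioo (0 : ℝ) π, φ θ ^ 2 * sin θ ^ (n - 2)
        ≤ -C * ∫ θ in Set.Ioo (0 : ℝ) π, φ θ ^ 2 * sin θ ^ n := by
  intro C hC
  obtain ⟨k, rfl⟩ : ∃ k, n = k + 3 := ⟨n - 3, by omega⟩
  simp only [show k + 3 - 2 = k + 1 by omega]
  set a : ℝ := ((k : ℝ) + 2) / 2 with ha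
  have ha0 : 0 < a := by positivity
  have hμa : 0 < -μ - a ^ 2 := by
    push_cast at hμ
    rw [ha]
    nlinarith
  set η := (-μ - a ^ 2) / 3 with hη
  have hη0 : 0 < η := by positivity
  set B := 1 + a ^ 2 / η with hB
  have hB0 : 0 < B := by positivity
  have hBη (x y : ℝ) : (x - a * y) ^ 2 ≤ B * x ^ 2 + (a ^ 2 + η) * y ^ 2 := by
    have h1 : B * x ^ 2 + (a ^ 2 + η) * y ^ 2 - (x - a * y) ^ 2 = (a * x + η * y) ^ 2 / η := by
      rw [hB]
      field_simp
      ring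
    have h2 : 0 ≤ (a * x + η * y) ^ 2 / η := by positivity
    linarith
  obtain ⟨ψ, hψ, hψc, ⟨t₀, ht₀⟩, hψT, hψint⟩ :=
    exists_bump_small_energy (A := B / η) (by positivity) (log (η / C) - log 4)
  have hψd : Continuous (deriv ψ) := hψ.continuous_deriv (by simp)
  set w : ℝ → ℝ := fun θ => sin θ ^ (-a) with hw
  set φ : ℝ → ℝ := (Set.Ioo 0 π).indicator fun θ => w θ * ψ (logTanHalf θ)
  have hsin {θ : ℝ} (h : θ ∈ Set.Ioo 0 π) : 0 < sin θ := sin_pos_of_pos_of_lt_pi h.1 h.2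
  have hwsq {θ : ℝ} (h : θ ∈ Set.Ioo 0 π) : w θ ^ 2 * sin θ ^ (k + 2) = 1 := by
    have := hsin h
    rw [hw, ← rpow_natCast, ← rpow_natCast, ← rpow_mul this.le, ← rpow_add this, ha]
    push_cast
    ring_nf
    exact rpow_zero _
  have hφ_eq {θ : ℝ} (h : θ ∈ Set.Ioo 0 π) : φ θ = w θ * ψ (logTanHalf θ) :=
    Set.indicator_of_mem h _
  have hφ_ev {θ : ℝ} (h : θ ∈ Set.Ioo 0 π) :
      φ =ᶠ[nhds θ] fun θ => w θ * ψ (logTanHalf θ) := by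
    filter_upwards [isOpen_Ioo.mem_nhds h] with x hx using hφ_eq hx
  have hK : IsCompact (gudermann '' tsupport ψ) := hψc.isCompact.image continuous_gudermann
  have hsub : Function.support φ ⊆ gudermann '' tsupport ψ := by
    intro θ hθ
    have h : θ ∈ Set.Ioo 0 π := Set.mem_of_indicator_ne_zero hθ
    refine ⟨logTanHalf θ, subset_tsupport _ fun h0 => hθ ?_, gudermann_logTanHalf h⟩
    rw [hφ_eq h, h0, mul_zero]
  have hφc : HasCompactSupport φ := .of_support_subset_isCompact hK hsub
  have hts : tsupport φ ⊆ Set.Ioo 0 π := by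
    refine (closure_minimal hsub hK.isClosed).trans ?_
    rintro _ ⟨t, -, rfl⟩
    exact gudermann_mem t
  have hφs : ContDiff ℝ (⊤ : ℕ∞) φ := by
    refine contDiff_iff_contDiffAt.2 fun θ => ?_
    by_cases h : θ ∈ Set.Ioo 0 π
    · refine ContDiffAt.congr_of_eventuallyEq ?_ (hφ_ev h)
      exact (contDiff_sin.contDiffAt.rpow_const_of_ne (hsin h).ne').mul
        (hψ.contDiffAt.comp θ (contDiffAt_logTanHalf h))
    · have : φ =ᶠ[nhds θ] 0 := notMem_tsupport_iff_eventuallyEq.1 fun hmem => h (hts hmem)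
      exact contDiffAt_const.congr_of_eventuallyEq this
  have hφ_deriv {θ : ℝ} (h : θ ∈ Set.Ioo 0 π) : deriv φ θ =
      w θ * (sin θ)⁻¹ * (deriv ψ (logTanHalf θ) - a * (cos θ * ψ (logTanHalf θ))) := by
    have hs := hsin h
    rw [(hφ_ev h).deriv_eq]
    have h1 := (hasDerivAt_sin θ).rpow_const (p := -a) (Or.inl hs.ne')
    have h2 := ((hψ.differentiable (by simp)) (logTanHalf θ)).hasDerivAt.comp θ
      (hasDerivAt_logTanHalf h)
    rw [rpow_sub_one hs.ne'] at h1
    refine (h1.mul h2).deriv.trans ?_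
    simp only [hw, Function.comp]
    field_simp
    ring
  have hφd : Continuous (deriv φ) := hφs.continuous_deriv (by simp)
  have hi {f : ℝ → ℝ} (hf : Continuous f) (hfc : HasCompactSupport f) (m : ℕ) :
      IntegrableOn (fun θ => f θ ^ 2 * sin θ ^ m) (Set.Ioo 0 π) := by
    refine Integrable.integrableOn (Continuous.integrable_of_hasCompactSupport (by fun_prop) ?_)
    exact hfc.mono fun x hx h => hx (by simp [h])
  have hi1 := hi hφd hφc.deriv (k + 3)
  have hi2 := hi hφs.continuous hφc (k + 1)
  have hi3 := hi hφs.continuous hφc (k + 3)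
  have hi12 : IntegrableOn (fun θ => deriv φ θ ^ 2 * sin θ ^ (k + 3) +
      μ * (φ θ ^ 2 * sin θ ^ (k + 1))) (Set.Ioo 0 π) := hi1.add (hi2.const_mul μ)
  have hi123 : IntegrableOn (fun θ => deriv φ θ ^ 2 * sin θ ^ (k + 3) +
      μ * (φ θ ^ 2 * sin θ ^ (k + 1)) + C * (φ θ ^ 2 * sin θ ^ (k + 3))) (Set.Ioo 0 π) :=
    hi12.add (hi3.const_mul C)
  have hG : Integrable fun t => η * (B / η * deriv ψ t ^ 2 - ψ t ^ 2) := by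
    refine Continuous.integrable_of_hasCompactSupport (by fun_prop) ?_
    refine hψc.mono' (Function.support_subset_iff'.2 fun t ht => ?_)
    rw [image_eq_zero_of_notMem_tsupport ht,
      image_eq_zero_of_notMem_tsupport fun h => ht (tsupport_deriv_subset h)]
    simp
  refine ⟨φ, hφs, hφc, hts, fun h0 => ?_, ?_⟩
  · have h1 := hφ_eq (gudermann_mem t₀)
    rw [h0, logTanHalf_gudermann] at h1
    exact mul_ne_zero (rpow_pos_of_pos (hsin (gudermann_mem t₀)) _).ne' ht₀ h1.symm
  rw [neg_mul, ← sub_nonpos, sub_neg_eq_add, ← integral_const_mul, ← integral_const_mul,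
    ← integral_add hi1 (hi2.const_mul μ),
    ← integral_add hi12 (hi3.const_mul C)]
  have hmono := setIntegral_mono_on hi123 (integrableOn_comp_logTanHalf hG) measurableSet_Ioo fun θ h => ?_
  · refine hmono.trans ?_
    refine (integral_comp_logTanHalf
      fun t => η * (B / η * deriv ψ t ^ 2 - ψ t ^ 2)).trans_le ?_
    rw [integral_const_mul]
    exact mul_nonpos_of_nonneg_of_nonpos hη0.le hψint
  have hs := hsin h
  set p := deriv ψ (logTanHalf θ)
  set q := ψ (logTanHalf θ) with hq
  have e1 : deriv φ θ ^ 2 * sin θ ^ (k + 3) = (sin θ)⁻¹ * (p - a * (cos θ * q)) ^ 2 := by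
    rw [hφ_deriv h]
    calc _ = (w θ ^ 2 * sin θ ^ (k + 2)) * ((sin θ)⁻¹ ^ 2 * sin θ) * (p - a * (cos θ * q)) ^ 2 := by
          ring
      _ = _ := by rw [hwsq h]; field_simp
  have e2 : φ θ ^ 2 * sin θ ^ (k + 1) = (sin θ)⁻¹ * q ^ 2 := by
    rw [hφ_eq h]
    calc _ = (w θ ^ 2 * sin θ ^ (k + 2)) * ((sin θ)⁻¹ * q ^ 2) := by
          rw [← hq]
          field_simp
          ring
      _ = _ := by rw [hwsq h, one_mul]
  have e3 : φ θ ^ 2 * sin θ ^ (k + 3) = (sin θ)⁻¹ * (sin θ ^ 2 * q ^ 2) := by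
    linear_combination sin θ ^ 2 * e2
  have hsmall : C * (sin θ ^ 2 * q ^ 2) ≤ η * q ^ 2 := by
    by_cases hq0 : q = 0
    · simp [hq0]
    have h1 : exp (logTanHalf θ) ≤ η / C / 4 := by
      have := exp_le_exp.2 (hψT _ hq0)
      rwa [exp_sub, exp_log (by positivity), exp_log (by norm_num)] at this
    have h2 := sin_le_two_mul_exp_logTanHalf h
    have h3 : sin θ ^ 2 ≤ η / C := by
      have : 0 < η / C := by positivity
      nlinarith [sin_le_one θ]
    rw [le_div_iff₀ hC] at h3
    nlinarith [sq_nonneg q]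
  have hcos : (cos θ * q) ^ 2 ≤ q ^ 2 := by
    rw [mul_pow]
    exact mul_le_of_le_one_left (sq_nonneg q) (cos_sq_le_one θ)
  have hmain := hBη p (cos θ * q)
  have hcos' : (a ^ 2 + η) * (cos θ * q) ^ 2 ≤ (a ^ 2 + η) * q ^ 2 := by gcongr
  have hμη : μ = -a ^ 2 - 3 * η := by rw [hη]; ring
  have hBη' : η * (B / η * p ^ 2 - q ^ 2) = B * p ^ 2 - η * q ^ 2 := by field_simp
  rw [e1, e2, e3, hBη']
  have hfinal : (p - a * (cos θ * q)) ^ 2 + μ * q ^ 2 + C * (sin θ ^ 2 * q ^ 2) ≤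
      B * p ^ 2 - η * q ^ 2 := by
    rw [hμη]
    linarith
  calc _ = (sin θ)⁻¹ * ((p - a * (cos θ * q)) ^ 2 + μ * q ^ 2 + C * (sin θ ^ 2 * q ^ 2)) := by ring
    _ ≤ _ := mul_le_mul_of_nonneg_left hfinal (inv_pos.2 hs).le
end
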